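/- arXiv:2210.06263 — 2 statements merged into one kernel-verified Lean document; each statement's English description precedes it below -/
import Mathlib

section
/- Let m ≥ 1 and let ℓ_1, ..., ℓ_m be natural numbers, with the convention ℓ_{m+1} = 0. Assume: (a) ℓ_i ≥ ℓ_j whenever 1 ≤ i and i + 2 ≤ j ≤ m; (b) either ℓ_1 ≥ ℓ_2 or ℓ_1 + 1 = ℓ_2; (c) for each 2 ≤ i ≤ m at least one of the following holds: (ℓ_{i−1} ≥ ℓ_i and ℓ_i ≥ ℓ_{i+1}), or (ℓ_i + 1 = ℓ_{i+1} and ℓ_{i−1} > ℓ_i), or (ℓ_i = ℓ_{i−1} + 1 and ℓ_{i+1} < ℓ_i). For 1 ≤ i ≤ m define t_i = 2ℓ_i + 1 if ℓ_i + 1 = ℓ_{i+1}; otherwise t_i = 2ℓ_i − 1 if i ≥ 2 and ℓ_i = ℓ_{i−1} + 1; otherwise t_i = 2ℓ_i. Then t_1 ≥ t_2 ≥ ... ≥ t_m, i.e. (t_1, ..., t_m) is a partition. -/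
/-- The modified descent index of a largest descent sequence index `(2ℓ_1, …, 2ℓ_m)`
(with the convention `ℓ_{m+1} = 0`) is a partition: under the constraints
(a) `ℓ_i ≥ ℓ_j` for `j ≥ i + 2`,
(b) `ℓ_1 ≥ ℓ_2` or `ℓ_1 + 1 = ℓ_2`,
(c) for `2 ≤ i ≤ m`, one of `(ℓ_{i−1} ≥ ℓ_i ∧ ℓ_i ≥ ℓ_{i+1})`,
`(ℓ_i + 1 = ℓ_{i+1} ∧ ℓ_{i−1} > ℓ_i)`, `(ℓ_i = ℓ_{i−1} + 1 ∧ ℓ_{i+1} < ℓ_i)`,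
the modification `t_i` (`= 2ℓ_i + 1` if `ℓ_i + 1 = ℓ_{i+1}`; else `= 2ℓ_i − 1` if
`i ≥ 2` and `ℓ_i = ℓ_{i−1} + 1`; else `= 2ℓ_i`) is nonincreasing:
`t_1 ≥ t_2 ≥ ⋯ ≥ t_m`. -/
theorem descent_partition_is_partition (m : ℕ) (hm : 1 ≤ m)
    (ℓ : ℕ → ℕ) (hend : ℓ (m + 1) = 0)
    (ha : ∀ i j : ℕ, 1 ≤ i → i + 2 ≤ j → j ≤ m → ℓ j ≤ ℓ i)
    (hb : ℓ 2 ≤ ℓ 1 ∨ ℓ 1 + 1 = ℓ 2)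
    (hc : ∀ i : ℕ, 2 ≤ i → i ≤ m →
      (ℓ i ≤ ℓ (i - 1) ∧ ℓ (i + 1) ≤ ℓ i) ∨
      (ℓ i + 1 = ℓ (i + 1) ∧ ℓ i < ℓ (i - 1)) ∨
      (ℓ i = ℓ (i - 1) + 1 ∧ ℓ (i + 1) < ℓ i))
    (t : ℕ → ℕ)
    (ht : ∀ i : ℕ, t i =
      if ℓ i + 1 = ℓ (i + 1) then 2 * ℓ i + 1
      else if 2 ≤ i ∧ ℓ i = ℓ (i - 1) + 1 then 2 * ℓ i - 1
      else 2 * ℓ i) :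
    ∀ i : ℕ, 1 ≤ i → i + 1 ≤ m → t (i + 1) ≤ t i := by
  intro i hi him
  have hsucc := hc (i + 1) (by omega) him
  have hi' := hc i
  rw [ht i, ht (i + 1)]
  simp only [Nat.add_sub_cancel] at hsucc ⊢
  split_ifs <;> omega
end

section
/- Let G be a finite group, let C, X, Y be subgroups of G, and let ψ : C → ℂˣ be a group homomorphism such that: (1) X and Y normalize C; (2) X ∩ C is normal in X and Y ∩ C is normal in Y, and the quotient groups X/(X∩C) and Y/(Y∩C) are abelian; (3) ψ(g c g⁻¹) = ψ(c) for all c ∈ C and all g ∈ X ∪ Y; (4) ψ is trivial on X ∩ C and on Y ∩ C; (5) the commutator [x, y] = x y x⁻¹ y⁻¹ lies in C for all x ∈ X and y ∈ Y; (6) the pairing X/(X∩C) × Y/(Y∩C) → ℂˣ sending (x(X∩C), y(Y∩C)) to ψ([x, y]) is well defined and multiplicative in each variable, and the two group homomorphisms it induces, X/(X∩C) → Hom(Y/(Y∩C), ℂˣ) and Y/(Y∩C) → Hom(X/(X∩C), ℂˣ), are bijective. Let χ be the character of a finite-dimensional complex representation of G. Then |X ∩ C| · Σ_{c ∈ C}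 Σ_{y ∈ Y} χ(c y) ψ(c)⁻¹ = Σ_{c ∈ C} Σ_{x ∈ X} Σ_{y ∈ Y} χ(c x y) ψ(c)⁻¹. -/
open scoped BigOperators

/-- The sum over `c ∈ C` of `χ (c * g)` twisted by the inverse of `ψ`. -/
noncomputable def twistedSum {G : Type*} [Group G] (C : Subgroup G) [Fintype C]
    (ψ : G → ℂˣ) (χ : G → ℂ) (g : G) : ℂ :=
  ∑ c : C, χ ((c : G) * g) * (((ψ (c : G))⁻¹ : ℂˣ) : ℂ)

/-- Left translation by an element of `C` multiplies `twistedSum` by the value of `ψ`. -/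
theorem twistedSum_mul_left {G : Type*} [Group G] (C : Subgroup G) [Fintype C]
    (ψ : G → ℂˣ) (χ : G → ℂ)
    (hψ : ∀ c ∈ C, ∀ c' ∈ C, ψ (c * c') = ψ c * ψ c') {a : G} (ha : a ∈ C) (g : G) :
    twistedSum C ψ χ (a * g) = ψ a * twistedSum C ψ χ g := by
  unfold twistedSum
  rw [Finset.mul_sum, ← Equiv.sum_comp (Equiv.mulRight (⟨a, ha⟩ : C))
    (fun c : C => (ψ a : ℂ) * (χ ((c : G) * g) * (((ψ (c : G))⁻¹ : ℂˣ) : ℂ)))]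
  refine Finset.sum_congr rfl fun c _ => ?_
  simp only [Equiv.coe_mulRight, Subgroup.coe_mul, hψ _ c.2 _ ha, mul_inv, Units.val_mul,
    mul_assoc]
  rw [mul_left_comm, mul_left_comm (ψ a : ℂ), Units.mul_inv, mul_one, mul_comm]

/-- `twistedSum` of a class function is invariant under conjugation by any element that
normalizes `C` and fixes `ψ`. -/
theorem twistedSum_conj {G : Type*} [Group G] (C : Subgroup G) [Fintype C]
    (ψ : G → ℂˣ) (χ : G → ℂ) (hχ : ∀ g h : G, χ (h * g * h⁻¹) = χ g) {y : G}
    (hy : ∀ c ∈ C, y * c * y⁻¹ ∈ C) (hψ : ∀ c ∈ C, ψ (y * c * y⁻¹) = ψ c) (g : G) :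
    twistedSum C ψ χ (y * g * y⁻¹) = twistedSum C ψ χ g := by
  have hinj : Function.Injective fun c : C => (⟨y * c * y⁻¹, hy c c.2⟩ : C) := by
    intro c d h
    simpa using h
  unfold twistedSum
  symm
  refine Fintype.sum_bijective _ (Finite.injective_iff_bijective.mp hinj) _ _ fun c => ?_
  rw [hψ c c.2, ← hχ (c * g) y]
  congr 2
  group

/-- If `ψ` is nontrivial on the commutator `[x, y']`, then `twistedSum` vanishes at `x * y`. -/
theorem twistedSum_mul_eq_zero {G : Type*} [Group G] (C : Subgroup G) [Fintype C]
    (ψ : G → ℂˣ) (χ : G → ℂ) (hχ : ∀ g h : G, χ (h * g * h⁻¹) = χ g)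
    (hψ : ∀ c ∈ C, ∀ c' ∈ C, ψ (c * c') = ψ c * ψ c') {x y y' : G}
    (hxC : ∀ c ∈ C, x * c * x⁻¹ ∈ C) (hψx : ∀ c ∈ C, ψ (x * c * x⁻¹) = ψ c)
    (hyC : ∀ c ∈ C, y' * c * y'⁻¹ ∈ C) (hψy : ∀ c ∈ C, ψ (y' * c * y'⁻¹) = ψ c)
    (hyy : y' * y * y'⁻¹ * y⁻¹ ∈ C) (hψyy : ψ (y' * y * y'⁻¹ * y⁻¹) = 1)
    (hxy : x * y' * x⁻¹ * y'⁻¹ ∈ C) (hne : ψ (x * y' * x⁻¹ * y'⁻¹) ≠ 1) :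
    twistedSum C ψ χ (x * y) = 0 := by
  have h : (x * y' * x⁻¹ * y'⁻¹) * (y' * (x * y) * y'⁻¹) =
      (x * (y' * y * y'⁻¹ * y⁻¹) * x⁻¹) * (x * y) := by group
  have h' := congrArg (twistedSum C ψ χ) h
  rw [twistedSum_mul_left C ψ χ hψ hxy, twistedSum_conj C ψ χ hχ hyC hψy,
    twistedSum_mul_left C ψ χ hψ (hxC _ hyy), hψx _ hyy, hψyy, Units.val_one] at h'
  by_contra h0
  exact hne (Units.ext (mul_right_cancel₀ h0 h'))

/-- The exchanging-roots lemma (finite-group form). Let `C, X, Y ≤ G` with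
(1) `X` and `Y` normalizing `C`; (2) `X ∩ C ⊴ X`, `Y ∩ C ⊴ Y` with abelian quotients
(encoded by commutators lying in `C`); (3) `ψ` preserved by conjugation by `X ∪ Y`;
(4) `ψ` trivial on `X ∩ C` and `Y ∩ C`; (5) `[X, Y] ⊆ C`;
(6) the commutator pairing `(x, y) ↦ ψ([x,y])` is well defined and bimultiplicative on
`X/(X∩C) × Y/(Y∩C)` and identifies each factor with the character group of the other.
Then for the character `χ` of any finite-dimensional complex representation of `G`,
`|X ∩ C| · Σ_{c∈C} Σ_{y∈Y} χ(cy) ψ(c)⁻¹ = Σ_{c∈C} Σ_{x∈X} Σ_{y∈Y} χ(cxy) ψ(c)⁻¹`. -/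
theorem exchanging_roots (G : Type) [Group G] [Fintype G]
    (C X Y : Subgroup G)
    [DecidablePred (· ∈ C)] [DecidablePred (· ∈ X)] [DecidablePred (· ∈ Y)]
    (ψ : G → ℂˣ)
    (hψhom : ∀ c ∈ C, ∀ c' ∈ C, ψ (c * c') = ψ c * ψ c')
    -- (1) X and Y normalize C
    (hXC : ∀ x ∈ X, ∀ c ∈ C, x * c * x⁻¹ ∈ C)
    (hYC : ∀ y ∈ Y, ∀ c ∈ C, y * c * y⁻¹ ∈ C)
    -- (2) X ∩ C is normal in X, Y ∩ C is normal in Y, with abelian quotients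
    (hXn : ∀ x ∈ X, ∀ g ∈ X ⊓ C, x * g * x⁻¹ ∈ X ⊓ C)
    (hYn : ∀ y ∈ Y, ∀ g ∈ Y ⊓ C, y * g * y⁻¹ ∈ Y ⊓ C)
    (hXab : ∀ x ∈ X, ∀ x' ∈ X, x * x' * x⁻¹ * x'⁻¹ ∈ X ⊓ C)
    (hYab : ∀ y ∈ Y, ∀ y' ∈ Y, y * y' * y⁻¹ * y'⁻¹ ∈ Y ⊓ C)
    -- (3) X and Y preserve ψ
    (hψX : ∀ x ∈ X, ∀ c ∈ C, ψ (x * c * x⁻¹) = ψ c)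
    (hψY : ∀ y ∈ Y, ∀ c ∈ C, ψ (y * c * y⁻¹) = ψ c)
    -- (4) ψ is trivial on X ∩ C and on Y ∩ C
    (hψXC : ∀ g ∈ X ⊓ C, ψ g = 1)
    (hψYC : ∀ g ∈ Y ⊓ C, ψ g = 1)
    -- (5) [X, Y] ⊆ C
    (hcomm : ∀ x ∈ X, ∀ y ∈ Y, x * y * x⁻¹ * y⁻¹ ∈ C)
    -- (6) the pairing is well defined ...
    (hwdX : ∀ x ∈ X, ∀ x' ∈ X, x⁻¹ * x' ∈ C → ∀ y ∈ Y,
      ψ (x * y * x⁻¹ * y⁻¹) = ψ (x' * y * x'⁻¹ * y⁻¹))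
    (hwdY : ∀ y ∈ Y, ∀ y' ∈ Y, y⁻¹ * y' ∈ C → ∀ x ∈ X,
      ψ (x * y * x⁻¹ * y⁻¹) = ψ (x * y' * x⁻¹ * y'⁻¹))
    -- ... multiplicative in each coordinate ...
    (hmulX : ∀ x ∈ X, ∀ x' ∈ X, ∀ y ∈ Y,
      ψ ((x * x') * y * (x * x')⁻¹ * y⁻¹) =
        ψ (x * y * x⁻¹ * y⁻¹) * ψ (x' * y * x'⁻¹ * y⁻¹))
    (hmulY : ∀ x ∈ X, ∀ y ∈ Y, ∀ y' ∈ Y,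
      ψ (x * (y * y') * x⁻¹ * (y * y')⁻¹) =
        ψ (x * y * x⁻¹ * y⁻¹) * ψ (x * y' * x⁻¹ * y'⁻¹))
    -- ... and the induced homomorphisms are bijective: injectivity (non-degeneracy)
    (hinjX : ∀ x ∈ X, (∀ y ∈ Y, ψ (x * y * x⁻¹ * y⁻¹) = 1) → x ∈ C)
    (hinjY : ∀ y ∈ Y, (∀ x ∈ X, ψ (x * y * x⁻¹ * y⁻¹) = 1) → y ∈ C)
    -- ... and surjectivity
    (hsurX : ∀ f : G → ℂˣ, (∀ y ∈ Y, ∀ y' ∈ Y, f (y * y') = f y * f y') →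
      (∀ g ∈ Y ⊓ C, f g = 1) → ∃ x ∈ X, ∀ y ∈ Y, f y = ψ (x * y * x⁻¹ * y⁻¹))
    (hsurY : ∀ f : G → ℂˣ, (∀ x ∈ X, ∀ x' ∈ X, f (x * x') = f x * f x') →
      (∀ g ∈ X ⊓ C, f g = 1) → ∃ y ∈ Y, ∀ x ∈ X, f x = ψ (x * y * x⁻¹ * y⁻¹))
    -- χ is the character of a finite-dimensional complex representation of G
    (ρ : FDRep ℂ G) :
    (Nat.card ↥(X ⊓ C) : ℂ) *
        ∑ c : C, ∑ y : Y, ρ.character ((c : G) * (y : G)) * (((ψ (c : G))⁻¹ : ℂˣ) : ℂ) =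
      ∑ c : C, ∑ x : X, ∑ y : Y,
        ρ.character ((c : G) * (x : G) * (y : G)) * (((ψ (c : G))⁻¹ : ℂˣ) : ℂ) := by
  classical
  have hχ : ∀ g h : G, ρ.character (h * g * h⁻¹) = ρ.character g := fun g h =>
    FDRep.char_conj ρ g h
  set F := twistedSum C ψ ρ.character with hF
  have hL : ∑ c : C, ∑ y : Y, ρ.character ((c : G) * (y : G)) * (((ψ (c : G))⁻¹ : ℂˣ) : ℂ) =
      ∑ y : Y, F y := Finset.sum_comm
  have hR : ∑ c : C, ∑ x : X, ∑ y : Y,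
        ρ.character ((c : G) * (x : G) * (y : G)) * (((ψ (c : G))⁻¹ : ℂˣ) : ℂ) =
      ∑ x : X, ∑ y : Y, F (x * y) := by
    rw [Finset.sum_comm]
    refine Finset.sum_congr rfl fun x _ => ?_
    rw [Finset.sum_comm]
    simp only [hF, twistedSum, mul_assoc]
  have hterm : ∀ x : X, ∑ y : Y, F (x * y) = if (x : G) ∈ C then ∑ y : Y, F y else 0 := by
    intro x
    split_ifs with hx
    · refine Finset.sum_congr rfl fun y _ => ?_
      rw [hF, twistedSum_mul_left C ψ _ hψhom hx, hψXC x ⟨x.2, hx⟩, Units.val_one, one_mul]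
    · obtain ⟨y', hy', hne⟩ : ∃ y' ∈ Y, ψ (x * y' * (x : G)⁻¹ * y'⁻¹) ≠ 1 := by
        by_contra! h
        exact hx (hinjX x x.2 h)
      refine Finset.sum_eq_zero fun y _ => ?_
      have hyy := hYab y' hy' y y.2
      exact twistedSum_mul_eq_zero C ψ _ hχ hψhom (hXC x x.2) (hψX x x.2) (hYC y' hy')
        (hψY y' hy') hyy.2 (hψYC _ hyy) (hcomm x x.2 y' hy') hne
  have hcard : Nat.card ↥(X ⊓ C) = (Finset.univ.filter fun x : X => (x : G) ∈ C).card := by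
    rw [← Fintype.card_subtype, ← Nat.card_eq_fintype_card]
    exact Nat.card_congr (Equiv.subtypeSubtypeEquivSubtypeInter (· ∈ X) (· ∈ C)).symm
  rw [hL, hR, Finset.sum_congr rfl fun x _ => hterm x, ← Finset.sum_filter, Finset.sum_const,
    nsmul_eq_mul, hcard]
end
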